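/- Let G ∈ 𝒢₁(n, n−3) with n ≥ 5 and diameter 3, and let P₄ = v₁v₂v₃v₄ be a diametrical path of G (a shortest path between two vertices at distance 3). Then S_{{v₁,v₂}} = ∅ and S_{{v₃,v₄}} = ∅; consequently every vertex of V(G) \ V(P₄) belongs to S_{{v₁,v₂,v₃}} or S_{{v₂,v₃,v₄}}. -/

import Mathlib

open Matrix

/-- The normalized Laplacian matrix of a finite simple graph. -/
noncomputable def normLap {V : Type*} [Fintype V] [DecidableEq V] (G : SimpleGraph V) [DecidableRel G.Adj] :
    Matrix V V ℝ :=
  Matrix.of fun u v =>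
    if u = v then 1
    else if G.Adj u v then -1 / Real.sqrt ((G.degree u : ℝ) * (G.degree v : ℝ))
    else 0

/-- The (geometric) multiplicity of `μ` as an eigenvalue of the matrix `M`. -/
noncomputable def eigMult {V : Type*} [Fintype V] [DecidableEq V]
    (M : Matrix V V ℝ) (μ : ℝ) : ℕ :=
  Module.finrank ℝ (LinearMap.ker (M - μ • (1 : Matrix V V ℝ)).mulVecLin)

/-- The multiset of eigenvalues (with multiplicity) of a hermitian matrix. -/
noncomputable def eigMultiset {V : Type*} [Fintype V] [DecidableEq V]
    (M : Matrix V V ℝ) : Multiset ℝ :=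
  if h : M.IsHermitian then Finset.univ.val.map h.eigenvalues else 0

/-- The second-smallest eigenvalue (counted with multiplicity) of a hermitian matrix. -/
noncomputable def secondSmallestEig {V : Type*} [Fintype V] [DecidableEq V]
    (M : Matrix V V ℝ) : ℝ :=
  ((eigMultiset M).sort (· ≤ ·)).getD 1 0

/-- The independence number of a finite simple graph. -/
noncomputable def indepNum {V : Type*} [Fintype V] (G : SimpleGraph V) : ℕ :=
  sSup {k | ∃ s : Finset V, (∀ u ∈ s, ∀ v ∈ s, u ≠ v → ¬ G.Adj u v) ∧ s.card = k}

/-- `G ∈ 𝒢₁(n, n-3)`. -/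
def memG1Family {V : Type*} [Fintype V] [DecidableEq V]
    (G : SimpleGraph V) [DecidableRel G.Adj] (n : ℕ) : Prop :=
  G.Connected ∧ Fintype.card V = n ∧
    (∃ θ : ℝ, eigMult (normLap G) θ = n - 3) ∧
    secondSmallestEig (normLap G) ≠ 1 ∧
    indepNum G = 2

/-- `v₁v₂v₃v₄` is an induced path `P₄`. -/
def IsInducedP4 {V : Type*} (G : SimpleGraph V) (v1 v2 v3 v4 : V) : Prop :=
  G.Adj v1 v2 ∧ G.Adj v2 v3 ∧ G.Adj v3 v4 ∧
    ¬ G.Adj v1 v3 ∧ ¬ G.Adj v1 v4 ∧ ¬ G.Adj v2 v4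

/-- A cograph: no induced path on 4 vertices. -/
def IsCograph {V : Type*} (G : SimpleGraph V) : Prop :=
  ∀ a b c d : V, ¬ IsInducedP4 G a b c d

/-- `S_U`: vertices outside the path `P` whose neighborhood inside `P` is exactly `U`. -/
def Sset {V : Type*} (G : SimpleGraph V) (P U : Set V) : Set V :=
  {u | u ∉ P ∧ G.neighborSet u ∩ P = U}

/-- The graph `G₁`: two cliques `A` (of size `a+1`) and `B` (of size `b+1`) forming a complete
graph together, a vertex `u` joined to all of `A` and a vertex `w` joined to all of `B`. -/
def graphG1 (a b : ℕ) : SimpleGraph (Unit ⊕ (Fin (a + 1) ⊕ (Fin (b + 1) ⊕ Unit))) :=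
  SimpleGraph.fromRel fun x y =>
    match x, y with
    | Sum.inl _, Sum.inr (Sum.inl _) => True
    | Sum.inr (Sum.inl _), Sum.inr (Sum.inl _) => True
    | Sum.inr (Sum.inl _), Sum.inr (Sum.inr (Sum.inl _)) => True
    | Sum.inr (Sum.inr (Sum.inl _)), Sum.inr (Sum.inr (Sum.inl _)) => True
    | Sum.inr (Sum.inr (Sum.inl _)), Sum.inr (Sum.inr (Sum.inr _)) => True
    | _, _ => False

noncomputable instance (a b : ℕ) : DecidableRel (graphG1 a b).Adj := Classical.decRel _

/-- The graph `G₂` on `m + 2` vertices: a complete graph on `m + 1` vertices together with a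
pendant vertex attached to one of its vertices. -/
def graphG2 (m : ℕ) : SimpleGraph (Unit ⊕ Fin (m + 1)) :=
  SimpleGraph.fromRel fun x y =>
    match x, y with
    | Sum.inl _, Sum.inr j => j = 0
    | Sum.inr _, Sum.inr _ => True
    | _, _ => False

noncomputable instance (m : ℕ) : DecidableRel (graphG2 m).Adj := Classical.decRel _

/-- The join of a single vertex with the disjoint union of two complete graphs `K_m`. -/
def joinTwoCliques (m : ℕ) : SimpleGraph (Unit ⊕ (Fin m ⊕ Fin m)) :=
  SimpleGraph.fromRel fun x y =>
    match x, y with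
    | Sum.inl _, Sum.inr _ => True
    | Sum.inr (Sum.inl _), Sum.inr (Sum.inl _) => True
    | Sum.inr (Sum.inr _), Sum.inr (Sum.inr _) => True
    | _, _ => False

noncomputable instance (m : ℕ) : DecidableRel (joinTwoCliques m).Adj := Classical.decRel _

theorem det_submatrix_eq_zero_of_rank_lt {V : Type*} [Fintype V] [DecidableEq V] {k : ℕ}
    (M : Matrix V V ℝ) (hM : M.rank < k) (f g : Fin k → V) : (M.submatrix f g).det = 0 := by
  by_contra h
  have hu : IsUnit (M.submatrix f g) := (Matrix.isUnit_iff_isUnit_det _).2 (isUnit_iff_ne_zero.2 h)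
  have hr := Matrix.rank_of_isUnit _ hu
  have heq : M.submatrix f g =
      (1 : Matrix V V ℝ).submatrix f id * M * (1 : Matrix V V ℝ).submatrix id g := by
    ext i j
    simp [Matrix.mul_apply, Matrix.one_apply]
  have h1 := Matrix.rank_mul_le_left ((1 : Matrix V V ℝ).submatrix f id * M)
    ((1 : Matrix V V ℝ).submatrix id g)
  have h2 := Matrix.rank_mul_le_right ((1 : Matrix V V ℝ).submatrix f id) M
  rw [← heq, hr, Fintype.card_fin] at h1
  omega

/-- The matrix `A + s D`, where `A` is the adjacency matrix and `D` the degree matrix. -/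
noncomputable def adjAddDeg {V : Type*} [Fintype V] [DecidableEq V] (G : SimpleGraph V)
    [DecidableRel G.Adj] (s : ℝ) : Matrix V V ℝ :=
  Matrix.of fun u v => if u = v then s * G.degree u else if G.Adj u v then 1 else 0

theorem rank_adjAddDeg_le {V : Type*} [Fintype V] [DecidableEq V] (G : SimpleGraph V)
    [DecidableRel G.Adj] (θ : ℝ) :
    (adjAddDeg G (θ - 1)).rank + eigMult (normLap G) θ ≤ Fintype.card V := by
  set M := normLap G - θ • (1 : Matrix V V ℝ) with hM
  let S : Matrix V V ℝ := Matrix.diagonal fun v => Real.sqrt (G.degree v)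
  have heq : adjAddDeg G (θ - 1) = (-S) * M * S := by
    ext u v
    simp only [S, neg_mul, Matrix.neg_apply, Matrix.mul_diagonal, Matrix.diagonal_mul, hM,
      Matrix.sub_apply, Matrix.smul_apply, normLap, adjAddDeg, Matrix.of_apply, smul_eq_mul,
      Matrix.one_apply]
    split_ifs with h h'
    · subst h
      have := Real.mul_self_sqrt (Nat.cast_nonneg (α := ℝ) (G.degree u))
      linear_combination -(θ - 1) * this
    · have hu : (0 : ℝ) < G.degree u := by
        exact_mod_cast (G.degree_pos_iff_exists_adj u).2 ⟨v, h'⟩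
      have hv : (0 : ℝ) < G.degree v := by
        exact_mod_cast (G.degree_pos_iff_exists_adj v).2 ⟨u, h'.symm⟩
      have hu' := (Real.sqrt_pos.2 hu).ne'
      have hv' := (Real.sqrt_pos.2 hv).ne'
      rw [Real.sqrt_mul hu.le]
      field_simp
      simp
    · simp
  have h1 := Matrix.rank_mul_le_left ((-S) * M) S
  have h2 := Matrix.rank_mul_le_right (-S) M
  rw [← heq] at h1
  have h3 := M.mulVecLin.finrank_range_add_finrank_ker
  rw [Module.finrank_fintype_fun_eq_card] at h3
  have h4 : M.rank + eigMult (normLap G) θ = Fintype.card V := h3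
  omega

theorem degree_eq_of_clique_cover {V : Type*} [Fintype V] [DecidableEq V] (G : SimpleGraph V)
    [DecidableRel G.Adj] {a b d : V} (hab : G.Adj a b) (had : ¬ G.Adj a d)
    (hbd : ¬ G.Adj b d) (hcommon : ∀ w, G.Adj a w → ¬ G.Adj w d)
    (hcover : ∀ w, w ≠ a → w ≠ d → G.Adj a w ∨ G.Adj w d)
    (hclique : ∀ x y, G.Adj a x → G.Adj a y → x ≠ y → G.Adj x y) :
    G.degree b = G.degree a + (G.neighborFinset b ∩ G.neighborFinset d).card := by
  have h : G.neighborFinset b = insert a ((G.neighborFinset a).erase b) ∪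
      (G.neighborFinset b ∩ G.neighborFinset d) := by
    ext w
    simp only [SimpleGraph.mem_neighborFinset, Finset.mem_union, Finset.mem_insert,
      Finset.mem_erase, Finset.mem_inter]
    constructor
    · intro hw
      by_cases hwa : w = a
      · simp [hwa]
      have hwd : w ≠ d := by rintro rfl; exact hbd hw
      rcases hcover w hwa hwd with h | h
      · exact Or.inl (Or.inr ⟨hw.ne', h⟩)
      · exact Or.inr ⟨hw, h.symm⟩
    · rintro ((rfl | ⟨h1, h2⟩) | ⟨h1, -⟩)
      · exact hab.symm
      · exact hclique _ _ hab h2 (Ne.symm h1)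
      · exact h1
  have hd : Disjoint (insert a ((G.neighborFinset a).erase b))
      (G.neighborFinset b ∩ G.neighborFinset d) := by
    rw [Finset.disjoint_left]
    intro w hw hw'
    simp only [SimpleGraph.mem_neighborFinset, Finset.mem_insert,
      Finset.mem_erase, Finset.mem_inter] at hw hw'
    rcases hw with rfl | ⟨_, h⟩
    · exact had hw'.2.symm
    · exact hcommon w h hw'.2.symm
  have hb : b ∈ G.neighborFinset a := by simpa using hab
  have hpos : 0 < (G.neighborFinset a).card := Finset.card_pos.2 ⟨b, hb⟩
  rw [← G.card_neighborFinset_eq_degree b, h, Finset.card_union_of_disjoint hd,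
    Finset.card_insert_of_notMem (by simp), Finset.card_erase_of_mem hb,
    ← G.card_neighborFinset_eq_degree a, ← h]
  omega

/-- Evaluation of the minor with rows `v1, v2, v3, w` and columns `v2, v3, v4, v1`. -/
theorem minor_identity {V : Type*} [Fintype V] [DecidableEq V] (G : SimpleGraph V)
    [DecidableRel G.Adj] {s : ℝ} (hrank : (adjAddDeg G s).rank < 4) {v1 v2 v3 v4 : V} (w : V)
    (h12 : G.Adj v1 v2) (h23 : G.Adj v2 v3) (h34 : G.Adj v3 v4) (h13 : ¬ G.Adj v1 v3)
    (h14 : ¬ G.Adj v1 v4) (h24 : ¬ G.Adj v2 v4)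
    (n13 : v1 ≠ v3) (n14 : v1 ≠ v4) (n24 : v2 ≠ v4) :
    adjAddDeg G s w v1 =
      (adjAddDeg G s w v2 - s * G.degree v2 * (adjAddDeg G s w v3
        - s * G.degree v3 * adjAddDeg G s w v4) - adjAddDeg G s w v4) * (s * G.degree v1)
      + (adjAddDeg G s w v3 - s * G.degree v3 * adjAddDeg G s w v4) := by
  have := det_submatrix_eq_zero_of_rank_lt _ hrank ![v1, v2, v3, w] ![v2, v3, v4, v1]
  have e1 : ∀ v, adjAddDeg G s v v = s * G.degree v := fun v => by simp [adjAddDeg]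
  have e2 : ∀ u v, G.Adj u v → adjAddDeg G s u v = 1 := fun u v h => by simp [adjAddDeg, h, h.ne]
  have e3 : ∀ u v, u ≠ v → ¬ G.Adj u v → adjAddDeg G s u v = 0 := fun u v h h' => by
    simp [adjAddDeg, h, h']
  simp only [Matrix.det_succ_row_zero, Matrix.det_fin_zero, Fin.sum_univ_succ, Matrix.submatrix_apply,
    Fin.succAbove, Matrix.cons_val] at this
  simp [e1, e2 _ _ h12, e2 _ _ h23, e2 _ _ h34, e2 _ _ h12.symm, e2 _ _ h23.symm,
    e3 _ _ n13 h13, e3 _ _ n14 h14, e3 _ _ n24 h24, e3 _ _ n13.symm (fun h => h13 h.symm)] at this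
  linarith

theorem no_private_neighbor {V : Type*} [Fintype V] [DecidableEq V] (G : SimpleGraph V)
    [DecidableRel G.Adj] {s : ℝ} (hrank : (adjAddDeg G s).rank < 4) {v1 v2 v3 v4 u : V}
    (h12 : G.Adj v1 v2) (h23 : G.Adj v2 v3) (h34 : G.Adj v3 v4) (n14 : v1 ≠ v4)
    (h14 : ¬ G.Adj v1 v4) (hcommon : ∀ w, G.Adj v1 w → ¬ G.Adj w v4)
    (hind : ∀ a b c, a ≠ b → a ≠ c → b ≠ c → G.Adj a b ∨ G.Adj a c ∨ G.Adj b c)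
    (hu1 : G.Adj v1 u) (hu3 : ¬ G.Adj u v3) : False := by
  have h13 : ¬ G.Adj v1 v3 := fun h => hcommon _ h h34
  have h24 : ¬ G.Adj v2 v4 := hcommon _ h12
  have n13 : v1 ≠ v3 := by rintro rfl; exact h14 h34
  have n24 : v2 ≠ v4 := by rintro rfl; exact h14 h12
  have h41 : ¬ G.Adj v4 v1 := fun h => h14 h.symm
  have h31 : ¬ G.Adj v3 v1 := fun h => h13 h.symm
  have h42 : ¬ G.Adj v4 v2 := fun h => h24 h.symm
  have hcommon' : ∀ w, G.Adj v4 w → ¬ G.Adj w v1 := fun w h h' => hcommon w h'.symm h.symm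
  have hcover : ∀ w, w ≠ v1 → w ≠ v4 → G.Adj v1 w ∨ G.Adj w v4 := fun w h h' => by
    rcases hind v1 w v4 h.symm n14 h' with h | h | h
    exacts [Or.inl h, absurd h h14, Or.inr h]
  have hcover' : ∀ w, w ≠ v4 → w ≠ v1 → G.Adj v4 w ∨ G.Adj w v1 := fun w h h' =>
    (hcover w h' h).symm.imp (·.symm) (·.symm)
  have hcl : ∀ x y, G.Adj v1 x → G.Adj v1 y → x ≠ y → G.Adj x y := fun x y hx hy hxy => by
    rcases hind x y v4 hxy (by rintro rfl; exact h14 hx) (by rintro rfl; exact h14 hy)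
      with h | h | h
    exacts [h, absurd h (hcommon _ hx), absurd h (hcommon _ hy)]
  have hcl' : ∀ x y, G.Adj v4 x → G.Adj v4 y → x ≠ y → G.Adj x y := fun x y hx hy hxy => by
    rcases hind x y v1 hxy (by rintro rfl; exact h41 hx) (by rintro rfl; exact h41 hy)
      with h | h | h
    exacts [h, absurd h (hcommon' _ hx), absurd h (hcommon' _ hy)]
  have hd2 := degree_eq_of_clique_cover G h12 h14 h24 hcommon hcover hcl
  have hd3 := degree_eq_of_clique_cover G h34.symm h41 h31 hcommon' hcover' hcl'
  have hk3 : (G.neighborFinset v3 ∩ G.neighborFinset v1).card < G.degree v1 := by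
    rw [← G.card_neighborFinset_eq_degree]
    refine Finset.card_lt_card ⟨Finset.inter_subset_right, fun h => ?_⟩
    have := h (show u ∈ G.neighborFinset v1 by simpa using hu1)
    simp only [Finset.mem_inter, SimpleGraph.mem_neighborFinset] at this
    exact hu3 this.1.symm
  have hk3pos : 0 < (G.neighborFinset v3 ∩ G.neighborFinset v1).card :=
    Finset.card_pos.2 ⟨v2, by simp [h12, h23.symm]⟩
  have hk2 : (G.neighborFinset v2 ∩ G.neighborFinset v4).card ≤ G.degree v4 := by
    rw [← G.card_neighborFinset_eq_degree v4]
    exact Finset.card_le_card Finset.inter_subset_right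
  have e1 : ∀ v, adjAddDeg G s v v = s * G.degree v := fun v => by simp [adjAddDeg]
  have e2 : ∀ u v, G.Adj u v → adjAddDeg G s u v = 1 := fun u v h => by simp [adjAddDeg, h, h.ne]
  have e3 : ∀ u v, u ≠ v → ¬ G.Adj u v → adjAddDeg G s u v = 0 := fun u v h h' => by
    simp [adjAddDeg, h, h']
  have nu2 : u ≠ v2 := by rintro rfl; exact hu3 h23
  have nu3 : u ≠ v3 := by rintro rfl; exact h13 hu1
  have nu4 : u ≠ v4 := by rintro rfl; exact h14 hu1
  have hmu := minor_identity G hrank u h12 h23 h34 h13 h14 h24 n13 n14 n24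
  rw [e2 _ _ hu1.symm, e2 _ _ (hcl _ _ hu1 h12 nu2), e3 _ _ nu3 hu3,
    e3 _ _ nu4 (hcommon _ hu1)] at hmu
  have hx1 : s * G.degree v1 = 1 := by linarith
  have hm4 := minor_identity G hrank v4 h12 h23 h34 h13 h14 h24 n13 n14 n24
  rw [e3 _ _ n14.symm h41, e3 _ _ n24.symm h42, e2 _ _ h34.symm, e1, hx1] at hm4
  set k3 := (G.neighborFinset v3 ∩ G.neighborFinset v1).card
  have hd1pos : (0 : ℝ) < G.degree v1 := by exact_mod_cast (by omega : 0 < G.degree v1)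
  have hspos : 0 < s := by
    by_contra h
    nlinarith
  have hd4pos : (0 : ℝ) < G.degree v4 := by
    exact_mod_cast (G.degree_pos_iff_exists_adj v4).2 ⟨v3, h34.symm⟩
  have hd3' : (G.degree v3 : ℝ) = G.degree v4 + k3 := by exact_mod_cast hd3
  have hk3' : (k3 : ℝ) < G.degree v1 := by exact_mod_cast hk3
  have hk3pos' : (0 : ℝ) < k3 := by exact_mod_cast hk3pos
  by_cases hw : ∃ w, G.Adj v4 w ∧ ¬ G.Adj w v2
  · obtain ⟨w, hw4, hw2⟩ := hw
    have hmw := minor_identity G hrank w h34.symm h23.symm h12.symm h42 h41 h31 n24.symm n14.symm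
      n13.symm
    have nw3 : w ≠ v3 := by rintro rfl; exact hw2 h23.symm
    have nw2 : w ≠ v2 := by rintro rfl; exact h42 hw4
    have nw1 : w ≠ v1 := by rintro rfl; exact h41 hw4
    rw [e2 _ _ hw4.symm, e2 _ _ (hcl' _ _ hw4 h34.symm nw3), e3 _ _ nw2 hw2,
      e3 _ _ nw1 (hcommon' _ hw4)] at hmw
    have hx4 : s * G.degree v4 = 1 := by linarith
    have hk2' : (G.neighborFinset v2 ∩ G.neighborFinset v4).card < G.degree v4 := by
      rw [← G.card_neighborFinset_eq_degree v4]
      refine Finset.card_lt_card ⟨Finset.inter_subset_right, fun h => ?_⟩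
      have := h (show w ∈ G.neighborFinset v4 by simpa using hw4)
      simp only [Finset.mem_inter, SimpleGraph.mem_neighborFinset] at this
      exact hw2 this.1.symm
    set k2 := (G.neighborFinset v2 ∩ G.neighborFinset v4).card
    have hd2' : (G.degree v2 : ℝ) = G.degree v1 + k2 := by exact_mod_cast hd2
    have hk2'' : (k2 : ℝ) < G.degree v4 := by exact_mod_cast hk2'
    rw [hx4, hd2', hd3', mul_add, mul_add, hx1, hx4] at hm4
    have a1 : s * k2 < 1 := by nlinarith
    have a2 : s * k3 < 1 := by nlinarith
    have a3 : 0 < s * k3 := mul_pos hspos hk3pos'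
    have a4 : 0 ≤ s * k2 := mul_nonneg hspos.le (Nat.cast_nonneg _)
    nlinarith
  · push Not at hw
    have hk2' : (G.neighborFinset v2 ∩ G.neighborFinset v4) = G.neighborFinset v4 := by
      refine Finset.inter_eq_right.2 fun w h => ?_
      simp only [SimpleGraph.mem_neighborFinset] at h ⊢
      exact (hw w h).symm
    rw [hk2', G.card_neighborFinset_eq_degree] at hd2
    have hd2' : (G.degree v2 : ℝ) = G.degree v1 + G.degree v4 := by exact_mod_cast hd2
    rw [hd2', mul_add, hx1] at hm4
    have hx4pos : 0 < s * G.degree v4 := by positivity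
    have hx34 : s * G.degree v3 * (s * G.degree v4) = 2 := by
      refine mul_left_cancel₀ hx4pos.ne' ?_
      linarith
    by_cases hw' : ∃ w, G.Adj v4 w ∧ w ≠ v3
    · obtain ⟨w, hw4, nw3⟩ := hw'
      have nw1 : w ≠ v1 := by rintro rfl; exact h41 hw4
      have hmw := minor_identity G hrank w h12 h23 h34 h13 h14 h24 n13 n14 n24
      rw [e2 _ _ hw4.symm, e2 _ _ (hw _ hw4), e2 _ _ (hcl' _ _ hw4 h34.symm nw3),
        e3 _ _ nw1 (hcommon' _ hw4), hd2', mul_add, hx1] at hmw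
      have hx4 : s * G.degree v4 = 2 := by linarith
      rw [hx4] at hx34
      have : s * G.degree v3 = s * G.degree v4 + s * k3 := by rw [hd3']; ring
      have : 0 < s * k3 := mul_pos hspos hk3pos'
      linarith
    · push Not at hw'
      have hd4 : G.degree v4 = 1 := by
        rw [← G.card_neighborFinset_eq_degree, Finset.card_eq_one]
        refine ⟨v3, ?_⟩
        ext w
        simp only [SimpleGraph.mem_neighborFinset, Finset.mem_singleton]
        exact ⟨hw' w, by rintro rfl; exact h34.symm⟩
      rw [hd3', hd4, Nat.cast_one, mul_one] at hx34
      have hge : (1 : ℝ) + k3 ≤ G.degree v1 := by exact_mod_cast (by omega : 1 + k3 ≤ G.degree v1)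
      have h1 : (1 : ℝ) ≤ G.degree v1 := by linarith
      have hs : s ≤ 1 := by nlinarith
      have : s * (1 + k3) ≤ 1 := by nlinarith
      nlinarith

theorem adj_of_indepNum_eq_two {V : Type*} [Fintype V] (G : SimpleGraph V)
    (h : indepNum G = 2) (a b c : V) (hab : a ≠ b) (hac : a ≠ c) (hbc : b ≠ c) :
    G.Adj a b ∨ G.Adj a c ∨ G.Adj b c := by
  classical
  by_contra! hn
  obtain ⟨h1, h2, h3⟩ := hn
  have : 3 ≤ indepNum G := by
    refine le_csSup ⟨Fintype.card V, ?_⟩ ⟨{a, b, c}, ?_, Finset.card_eq_three.2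
      ⟨a, b, c, hab, hac, hbc, rfl⟩⟩
    · rintro k ⟨s, -, rfl⟩
      exact s.card_le_univ
    · have := fun h => h1 (G.adj_symm h)
      have := fun h => h2 (G.adj_symm h)
      have := fun h => h3 (G.adj_symm h)
      simp_all
  omega

theorem statement8 {V : Type*} [Fintype V] [DecidableEq V] (n : ℕ) (hn : 5 ≤ n)
    (G : SimpleGraph V) [DecidableRel G.Adj] (hG : memG1Family G n) (hdiam : G.diam = 3)
    (v1 v2 v3 v4 : V) (h12 : G.Adj v1 v2) (h23 : G.Adj v2 v3) (h34 : G.Adj v3 v4)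
    (hdist : G.dist v1 v4 = 3) :
    Sset G {v1, v2, v3, v4} {v1, v2} = ∅ ∧
    Sset G {v1, v2, v3, v4} {v3, v4} = ∅ ∧
    ∀ u : V, u ∉ ({v1, v2, v3, v4} : Set V) →
      u ∈ Sset G {v1, v2, v3, v4} {v1, v2, v3} ∨
      u ∈ Sset G {v1, v2, v3, v4} {v2, v3, v4} := by
  obtain ⟨-, hcard, ⟨θ, hθ⟩, -, hnu⟩ := hG
  have hrank := rank_adjAddDeg_le G θ
  replace hrank : (adjAddDeg G (θ - 1)).rank < 4 := by omega
  have hind := adj_of_indepNum_eq_two G hnu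
  have n14 : v1 ≠ v4 := by rintro rfl; simp at hdist
  have h14 : ¬ G.Adj v1 v4 := fun h => by
    have := G.dist_le h.toWalk
    simp [hdist] at this
  have hcommon : ∀ w, G.Adj v1 w → ¬ G.Adj w v4 := fun w h h' => by
    have := G.dist_le (SimpleGraph.Walk.cons h h'.toWalk)
    simp [hdist] at this
  have hcommon' : ∀ w, G.Adj v4 w → ¬ G.Adj w v1 := fun w h h' => hcommon w h'.symm h.symm
  have h41 : ¬ G.Adj v4 v1 := fun h => h14 h.symm
  have key : ∀ u, G.Adj v1 u → G.Adj u v3 := fun u h => by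
    by_contra h'
    exact no_private_neighbor G hrank h12 h23 h34 n14 h14 hcommon hind h h'
  have key' : ∀ u, G.Adj v4 u → G.Adj u v2 := fun u h => by
    by_contra h'
    exact no_private_neighbor G hrank h34.symm h23.symm h12.symm n14.symm h41 hcommon' hind h h'
  have n13 : v1 ≠ v3 := by rintro rfl; exact h14 h34
  have n24 : v2 ≠ v4 := by rintro rfl; exact h14 h12
  refine ⟨?_, ?_, ?_⟩
  · rw [Set.eq_empty_iff_forall_notMem]
    rintro u ⟨-, hu⟩
    have h1 : v1 ∈ G.neighborSet u ∩ {v1, v2, v3, v4} := by rw [hu]; simp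
    have h3 : v3 ∈ G.neighborSet u ∩ {v1, v2, v3, v4} := ⟨key u h1.1.symm, by simp⟩
    rw [hu] at h3
    simp [n13.symm, h23.ne'] at h3
  · rw [Set.eq_empty_iff_forall_notMem]
    rintro u ⟨-, hu⟩
    have h1 : v4 ∈ G.neighborSet u ∩ {v1, v2, v3, v4} := by rw [hu]; simp
    have h3 : v2 ∈ G.neighborSet u ∩ {v1, v2, v3, v4} := ⟨key' u h1.1.symm, by simp⟩
    rw [hu] at h3
    simp [n24, h23.ne] at h3
  · intro u hu
    have hu' := hu
    simp only [Set.mem_insert_iff, Set.mem_singleton_iff, not_or] at hu'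
    obtain ⟨m1, m2, m3, m4⟩ := hu'
    rcases hind v1 u v4 (Ne.symm m1) n14 m4 with h | h | h
    · left
      have a2 : G.Adj u v2 := by
        rcases hind u v2 v4 m2 m4 n24 with h' | h' | h'
        exacts [h', absurd h' (hcommon _ h), absurd h' (hcommon _ h12)]
      have a3 := key u h
      have a4 := hcommon _ h
      refine ⟨hu, ?_⟩
      ext x
      simp only [Set.mem_inter_iff, SimpleGraph.mem_neighborSet, Set.mem_insert_iff,
        Set.mem_singleton_iff]
      constructor
      · rintro ⟨hx, rfl | rfl | rfl | rfl⟩ <;> simp_all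
      · rintro (rfl | rfl | rfl) <;> simp [a2, a3, h.symm]
    · exact absurd h h14
    · right
      have a3 : G.Adj u v3 := by
        rcases hind u v3 v1 m3 m1 n13.symm with h' | h' | h'
        exacts [h', absurd h' (hcommon' _ h.symm), absurd h' (hcommon' _ h34.symm)]
      have a2 := key' u h.symm
      have a1 := hcommon' _ h.symm
      refine ⟨hu, ?_⟩
      ext x
      simp only [Set.mem_inter_iff, SimpleGraph.mem_neighborSet, Set.mem_insert_iff,
        Set.mem_singleton_iff]
      constructor
      · rintro ⟨hx, rfl | rfl | rfl | rfl⟩ <;> simp_all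
      · rintro (rfl | rfl | rfl) <;> simp [a2, a3, h]
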